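/- arXiv:2605.13582 — 2 statements merged into one kernel-verified Lean document; each statement's English description precedes it below -/
import Mathlib

section
/- (Kinetic mollification as averaging along trajectories, equation (2.7)/(eq:TrfK).) For every f ∈ 𝒮(ℝ^{1+2d}), every τ > 0 and every z = (t,x,v) ∈ ℝ^{1+2d}, one has ∫_{ℝ^{1+2d}} K_τ(z^{-1} ∘ m) f(m) dm = ∫_{ℝ^{1+2d}} f(γ^m(τ;(t,x,v))) ψ(m) dm, where in the right-hand integral m = (m_0,m_1,m_2) and the integrand vanishes unless m_0 ∈ (−2,−1) (so γ^m is well defined on the support of ψ). -/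
open MeasureTheory Real ENNReal
open scoped RealInnerProductSpace

noncomputable section

/-- Euclidean space `ℝ^d`. -/
abbrev V (d : ℕ) : Type := EuclideanSpace ℝ (Fin d)

/-- The kinetic phase space `ℝ^{1+2d}`, with points `(t, x, v)`. -/
abbrev Pt (d : ℕ) : Type := ℝ × V d × V d

/-- Kinetic composition `(t,x,v) ∘ (s,y,w) = (t+s, x+y+s v, v+w)`. -/
def kmul {d : ℕ} (a b : Pt d) : Pt d :=
  (a.1 + b.1, a.2.1 + b.2.1 + b.1 • a.2.2, a.2.2 + b.2.2)

/-- Kinetic inverse `(t,x,v)⁻¹ = (−t, −x+t v, −v)`. -/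
def kinv {d : ℕ} (a : Pt d) : Pt d :=
  (-a.1, -a.2.1 + a.1 • a.2.2, -a.2.2)

/-- `g₁(r) = r³ sin(log r)`, extended by `0` at `r = 0`. -/
def g1 (r : ℝ) : ℝ := r ^ 3 * Real.sin (Real.log r)

/-- `g₂(r) = r³ cos(log r)`, extended by `0` at `r = 0`. -/
def g2 (r : ℝ) : ℝ := r ^ 3 * Real.cos (Real.log r)

/-- `ġ₁(r)/(2r) = (r/2)(3 sin(log r) + cos(log r))`, extended by `0` at `r = 0`. -/
def h1 (r : ℝ) : ℝ := r / 2 * (3 * Real.sin (Real.log r) + Real.cos (Real.log r))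

/-- `ġ₂(r)/(2r) = (r/2)(3 cos(log r) − sin(log r))`, extended by `0` at `r = 0`. -/
def h2 (r : ℝ) : ℝ := r / 2 * (3 * Real.cos (Real.log r) - Real.sin (Real.log r))

/-- The matrix `W(r)`, recorded through its scalar block entries as a `2×2` real matrix;
the full `2d×2d` matrix is the blockwise tensor with `Id_d`. -/
def Wm (r : ℝ) : Matrix (Fin 2) (Fin 2) ℝ := !![g1 r, g2 r; h1 r, h2 r]

/-- The matrix `D_δ` (scalar block entries). -/
def Dm (δ : ℝ) : Matrix (Fin 2) (Fin 2) ℝ := !![δ, 0; 0, 1]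

/-- The matrix `E_δ(r)` (scalar block entries). -/
def Em (δ r : ℝ) : Matrix (Fin 2) (Fin 2) ℝ := !![1, δ * r ^ 2; 0, 1]

/-- `A_{m₀}(r) = D_{m₀} W(r) D_{m₀}⁻¹` (scalar block entries). -/
def Am (m0 r : ℝ) : Matrix (Fin 2) (Fin 2) ℝ := Dm m0 * Wm r * (Dm m0)⁻¹

/-- The action on `ℝ^d × ℝ^d` of a `2×2` block matrix whose blocks are the scalar
multiples of `Id_d` given by the entries of `M`. -/
def act {d : ℕ} (M : Matrix (Fin 2) (Fin 2) ℝ) (p : V d × V d) : V d × V d :=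
  (M 0 0 • p.1 + M 0 1 • p.2, M 1 0 • p.1 + M 1 1 • p.2)

/-- The kinetic trajectory `γ^m(r; (t,x,v))`. -/
def gammaK {d : ℕ} (m : Pt d) (z : Pt d) (r : ℝ) : Pt d :=
  (z.1 + m.1 * r ^ 2,
   (act (Em m.1 r) (z.2.1, z.2.2) + act (Am m.1 r) (m.2.1, m.2.2)).1,
   (act (Em m.1 r) (z.2.1, z.2.2) + act (Am m.1 r) (m.2.1, m.2.2)).2)

/-- Build a vector of `ℝ^d` from components. -/
def mkV {d : ℕ} (f : Fin d → ℝ) : V d := (EuclideanSpace.equiv (Fin d) ℝ).symm f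

/-- The argument `(s/r², A_{s/r²}(r)⁻¹ (y,w)ᵀ)` fed into `ψ`. -/
def psiArg {d : ℕ} (r : ℝ) (m : Pt d) : Pt d :=
  (m.1 / r ^ 2,
   (act ((Am (m.1 / r ^ 2) r)⁻¹) (m.2.1, m.2.2)).1,
   (act ((Am (m.1 / r ^ 2) r)⁻¹) (m.2.1, m.2.2)).2)

/-- The mollification kernel `K_r(s,y,w) = 2^d r^{−Q} ψ(s/r², A_{s/r²}(r)⁻¹(y,w)ᵀ)`,
with `Q = 4d+2`. -/
def Kker {d : ℕ} (ψ : Pt d → ℝ) (r : ℝ) (m : Pt d) : ℝ :=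
  2 ^ d * r ^ (-(4 * (d : ℤ) + 2)) * ψ (psiArg r m)

/-- The kernel `K̃_r(s,y,w) = −2^{d+1} s r^{−Q−1} ψ(s/r², A_{s/r²}(r)⁻¹(y,w)ᵀ)`. -/
def Ktil {d : ℕ} (ψ : Pt d → ℝ) (r : ℝ) (m : Pt d) : ℝ :=
  -(2 ^ (d + 1)) * m.1 * r ^ (-(4 * (d : ℤ) + 2) - 1) * ψ (psiArg r m)

/-- First coefficient of the forcing matrix `F_{m₀}(r)`: `(1/m₀) ∂_r (ġ₁(r)/(2r))`. -/
def F1 (m0 r : ℝ) : ℝ := (1 / m0) * deriv h1 r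

/-- Second coefficient of the forcing matrix `F_{m₀}(r)`: `∂_r (ġ₂(r)/(2r))`. -/
def F2 (r : ℝ) : ℝ := deriv h2 r

/-- The kernel `K⃗_r(s,y,w) = −2^d r^{−Q} ψ(⋯) F_{s/r²}(r) A_{s/r²}(r)⁻¹ (y,w)ᵀ ∈ ℝ^d`. -/
def Kvec {d : ℕ} (ψ : Pt d → ℝ) (r : ℝ) (m : Pt d) : V d :=
  (-(2 ^ d) * r ^ (-(4 * (d : ℤ) + 2)) * ψ (psiArg r m)) •
    (F1 (m.1 / r ^ 2) r • (act ((Am (m.1 / r ^ 2) r)⁻¹) (m.2.1, m.2.2)).1 +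
      F2 r • (act ((Am (m.1 / r ^ 2) r)⁻¹) (m.2.1, m.2.2)).2)

/-- The gradient of `u : ℝ^{1+2d} → ℝ` in the `x`-variables (the `m₁` block). -/
def gradX {d : ℕ} (u : Pt d → ℝ) (z : Pt d) : V d :=
  mkV fun i => fderiv ℝ u z (0, EuclideanSpace.single i 1, 0)

/-- The gradient of `u : ℝ^{1+2d} → ℝ` in the `v`-variables (the `m₂` block). -/
def gradV {d : ℕ} (u : Pt d → ℝ) (z : Pt d) : V d :=
  mkV fun i => fderiv ℝ u z (0, 0, EuclideanSpace.single i 1)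

/-- The kernel `K⃗^π_r(s,y,w)
  = 2^{d+1} s r^{−Q−1} [(A_{s/r²}(r)⁻¹)_{·;2}]ᵀ [∇_{(m₁,m₂)}ψ](⋯) ∈ ℝ^d`. -/
def Kpi {d : ℕ} (ψ : Pt d → ℝ) (r : ℝ) (m : Pt d) : V d :=
  (2 ^ (d + 1) * m.1 * r ^ (-(4 * (d : ℤ) + 2) - 1)) •
    ((Am (m.1 / r ^ 2) r)⁻¹ 0 1 • gradX ψ (psiArg r m) +
      (Am (m.1 / r ^ 2) r)⁻¹ 1 1 • gradV ψ (psiArg r m))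

/-- Kinetic convolution operator for scalar kernels:
`[T_J f](z) = ∫ J(z⁻¹ ∘ m) f(m) dm`. -/
def Tsc {d : ℕ} (J : Pt d → ℝ) (f : Pt d → ℝ) (z : Pt d) : ℝ :=
  ∫ m, J (kmul (kinv z) m) * f m

/-- Kinetic convolution operator for `ℝ^d`-valued kernels:
`[T_J f](z) = ∫ J(z⁻¹ ∘ m) · f(m) dm`. -/
def Tvec {d : ℕ} (J : Pt d → V d) (f : Pt d → V d) (z : Pt d) : ℝ :=
  ∫ m, ⟪J (kmul (kinv z) m), f m⟫

/-- The support and nonnegativity conditions on the bump function `ψ`: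
smooth, nonnegative, unit mass, supported in `(−2,−1) × B₁(0) × B₁(0)`. -/
structure IsKineticBump {d : ℕ} (ψ : Pt d → ℝ) : Prop where
  smooth : ContDiff ℝ (⊤ : ℕ∞) ψ
  nonneg : ∀ m, 0 ≤ ψ m
  mass : ∫ m, ψ m = 1
  supp : ∀ m : Pt d, ψ m ≠ 0 →
    m.1 ∈ Set.Ioo (-2 : ℝ) (-1) ∧ ‖m.2.1‖ < 1 ∧ ‖m.2.2‖ < 1

/-- The kinetic box `B_r^kin = {(s,y,w) : |s| < r², |y| < r³, |w| < r}`. -/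
def kinBox (d : ℕ) (r : ℝ) : Set (Pt d) :=
  {m | |m.1| < r ^ 2 ∧ ‖m.2.1‖ < r ^ 3 ∧ ‖m.2.2‖ < r}

theorem act_mul {d : ℕ} (M N : Matrix (Fin 2) (Fin 2) ℝ) (p : V d × V d) :
    act (M * N) p = act M (act N p) := by
  simp only [act, Matrix.mul_apply, Fin.sum_univ_two]
  ext1 <;> simp only <;> module

theorem act_one {d : ℕ} (p : V d × V d) : act 1 p = p := by
  simp [act]

/-- The action of a `2×2` block matrix as a linear map. -/
def actLin (d : ℕ) (M : Matrix (Fin 2) (Fin 2) ℝ) : (V d × V d) →ₗ[ℝ] (V d × V d) where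
  toFun := act M
  map_add' p q := by
    simp only [act]
    ext1 <;> simp only [Prod.fst_add, Prod.snd_add] <;> module
  map_smul' c p := by
    simp only [act, RingHom.id_apply]
    ext1 <;> simp only [Prod.smul_fst, Prod.smul_snd] <;> module

theorem actLin_apply {d : ℕ} (M : Matrix (Fin 2) (Fin 2) ℝ) (p : V d × V d) :
    actLin d M p = act M p := rfl

theorem det_actLin (d : ℕ) (M : Matrix (Fin 2) (Fin 2) ℝ) :
    LinearMap.det (actLin d M) = M.det ^ d := by
  let b := (EuclideanSpace.basisFun (Fin d) ℝ).toBasis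
  let e : Fin d ⊕ Fin d ≃ Fin 2 × Fin d :=
    (Equiv.boolProdEquivSum (Fin d)).symm.trans
      (Equiv.prodCongr finTwoEquiv.symm (Equiv.refl (Fin d)))
  have h : LinearMap.toMatrix (b.prod b) (b.prod b) (actLin d M) =
      (Matrix.kroneckerMap (· * ·) M (1 : Matrix (Fin d) (Fin d) ℝ)).submatrix e e := by
    ext (i | i) (j | j) <;>
      simp [LinearMap.toMatrix_apply, actLin_apply, act, b, e, finTwoEquiv, Matrix.one_apply]
  rw [← LinearMap.det_toMatrix (b.prod b), h, Matrix.det_submatrix_equiv_self,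
    Matrix.det_kronecker]
  simp

theorem inv_Dm (δ : ℝ) : (Dm δ)⁻¹ = !![δ⁻¹, 0; 0, δ⁻¹ * δ] := by
  simp [Dm, Matrix.inv_def, Matrix.adjugate_fin_two, Ring.inverse_eq_inv']

theorem Am_eq (m0 r : ℝ) :
    Am m0 r = !![m0 * g1 r * m0⁻¹, m0 * g2 r * (m0⁻¹ * m0);
      h1 r * m0⁻¹, h2 r * (m0⁻¹ * m0)] := by
  rw [Am, inv_Dm]
  simp [Dm, Wm]

theorem det_Am {m0 : ℝ} (hm : m0 ≠ 0) (r : ℝ) : (Am m0 r).det = -(r ^ 4 / 2) := by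
  rw [Am_eq, Matrix.det_fin_two_of]
  field_simp
  simp only [g1, g2, h1, h2]
  linear_combination (-r ^ 4) * Real.sin_sq_add_cos_sq (Real.log r)

theorem inv_Am (m0 r : ℝ) :
    (Am m0 r)⁻¹ = (Am m0 r).det⁻¹ • !![Am m0 r 1 1, -Am m0 r 0 1; -Am m0 r 1 0, Am m0 r 0 0] := by
  rw [Matrix.inv_def, Matrix.adjugate_fin_two, Ring.inverse_eq_inv']

theorem measurable_Am (r : ℝ) (i j : Fin 2) : Measurable fun s : ℝ => Am s r i j := by
  simp only [Am_eq]
  fin_cases i <;> fin_cases j <;> simp <;> fun_prop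

theorem measurable_inv_Am (r : ℝ) (i j : Fin 2) : Measurable fun s : ℝ => (Am s r)⁻¹ i j := by
  have := measurable_Am r
  simp only [inv_Am, Matrix.det_fin_two]
  fin_cases i <;> fin_cases j <;> simp <;> fun_prop

theorem measurable_act {d : ℕ} {α : Type*} [MeasurableSpace α]
    {M : α → Matrix (Fin 2) (Fin 2) ℝ} (hM : ∀ i j, Measurable fun a => M a i j)
    {p : α → V d × V d} (hp : Measurable p) : Measurable fun a => act (M a) (p a) :=
  (((hM 0 0).smul hp.fst).add ((hM 0 1).smul hp.snd)).prodMk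
    (((hM 1 0).smul hp.fst).add ((hM 1 1).smul hp.snd))

theorem measurable_psiArg {d : ℕ} (r : ℝ) : Measurable (psiArg (d := d) r) := by
  have ht : Measurable fun m : Pt d => m.1 / r ^ 2 := measurable_fst.div_const _
  have hact : Measurable fun m : Pt d => act (Am (m.1 / r ^ 2) r)⁻¹ m.2 :=
    measurable_act (fun i j => (measurable_inv_Am r i j).comp ht) measurable_snd
  exact ht.prodMk (hact.fst.prodMk hact.snd)

/-- An affine map with linear part `act M` scales Lebesgue measure by `|det M|^{-d}`. -/
theorem map_affine_volume {d : ℕ} {M : Matrix (Fin 2) (Fin 2) ℝ} (hM : M.det ≠ 0)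
    (q : V d × V d) :
    Measure.map (fun p => q + act M p) (volume : Measure (V d × V d)) =
      ENNReal.ofReal |(M.det ^ d)⁻¹| • volume := by
  have hdet : LinearMap.det (actLin d M) ≠ 0 := by
    rw [det_actLin]
    exact pow_ne_zero _ hM
  have hmeas : Measurable (actLin d M) :=
    (LinearMap.continuous_of_finiteDimensional (actLin d M)).measurable
  have : (volume : Measure (V d × V d)).IsAddHaarMeasure := by
    rw [Measure.volume_eq_prod]
    infer_instance
  calc Measure.map (fun p => q + act M p) (volume : Measure (V d × V d))
      = Measure.map (fun p => q + p) (Measure.map (actLin d M) volume) := by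
        rw [Measure.map_map (measurable_const_add q) hmeas]
        rfl
    _ = _ := by
        rw [Measure.map_linearMap_addHaar_eq_smul_addHaar _ hdet, Measure.map_smul,
          map_add_left_eq_self, det_actLin]

theorem map_time_volume {c : ℝ} (hc : c ≠ 0) (t : ℝ) :
    Measure.map (fun s : ℝ => t + s * c) volume = ENNReal.ofReal |c⁻¹| • volume := by
  calc Measure.map (fun s : ℝ => t + s * c) volume
      = Measure.map (fun s => t + s) (Measure.map (fun s => s * c) volume) := by
        rw [Measure.map_map (measurable_const_add t) (measurable_mul_const c)]
        rfl
    _ = _ := by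
        rw [Real.map_volume_mul_right hc, Measure.map_smul, map_add_left_eq_self]

/-- The trajectory map `m ↦ γ^m(τ; z)` pushes Lebesgue measure to `2^d τ^{-Q}` times itself. -/
theorem measurePreserving_gammaK {d : ℕ} {τ : ℝ} (hτ : 0 < τ) (z : Pt d) :
    MeasurePreserving (fun m : Pt d => gammaK m z τ) volume
      (ENNReal.ofReal (2 ^ d * τ ^ (-(4 * (d : ℤ) + 2))) • volume) := by
  have hτ2 : τ ^ 2 ≠ 0 := by positivity
  have key := MeasurePreserving.skew_product (μa := (volume : Measure ℝ))
    (μb := ENNReal.ofReal |(τ ^ 2)⁻¹| • (volume : Measure ℝ))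
    (μc := (volume : Measure (V d × V d)))
    (μd := ENNReal.ofReal |((-(τ ^ 4 / 2)) ^ d)⁻¹| • (volume : Measure (V d × V d)))
    (f := fun s => z.1 + s * τ ^ 2)
    (g := fun s p => act (Em s τ) (z.2.1, z.2.2) + act (Am s τ) p)
    ⟨by fun_prop, map_time_volume hτ2 z.1⟩
    (by
      refine (measurable_act (fun i j => ?_) measurable_const).add
        (measurable_act (fun i j => (measurable_Am τ i j).comp measurable_fst) measurable_snd)
      fin_cases i <;> fin_cases j <;> simp [Em] <;> fun_prop)
    (by
      have h0 : ∀ᵐ s : ℝ ∂volume, s ≠ 0 := by simp [ae_iff]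
      filter_upwards [h0] with s hs
      rw [map_affine_volume (by rw [det_Am hs]; exact neg_ne_zero.mpr (by positivity)), det_Am hs])
  have hconst : ENNReal.ofReal |(τ ^ 2)⁻¹| * ENNReal.ofReal |((-(τ ^ 4 / 2)) ^ d)⁻¹| =
      ENNReal.ofReal (2 ^ d * τ ^ (-(4 * (d : ℤ) + 2))) := by
    rw [← ENNReal.ofReal_mul (abs_nonneg _)]
    congr 1
    rw [abs_inv, abs_inv, abs_pow, abs_pow, abs_neg, abs_of_pos hτ,
      abs_of_pos (by positivity : 0 < τ ^ 4 / 2), zpow_neg, zpow_add₀ hτ.ne', zpow_mul]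
    norm_cast
    rw [div_pow]
    push_cast
    field_simp
  rw [Measure.prod_smul_left, Measure.prod_smul_right, smul_smul, hconst] at key
  exact key

theorem kmul_kinv_gammaK {d : ℕ} (m z : Pt d) (τ : ℝ) :
    kmul (kinv z) (gammaK m z τ) =
      (m.1 * τ ^ 2, act (Am m.1 τ) m.2) := by
  simp only [kmul, kinv, gammaK, act, Em, Matrix.of_apply, Matrix.cons_val',
    Matrix.cons_val_zero, Matrix.cons_val_one, Matrix.cons_val_fin_one]
  ext1
  · simp
  · ext1 <;> simp only [Prod.fst_add, Prod.snd_add] <;> module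

theorem psiArg_kmul_kinv_gammaK {d : ℕ} {m : Pt d} (hm : m.1 ≠ 0) (z : Pt d) {τ : ℝ}
    (hτ : 0 < τ) : psiArg τ (kmul (kinv z) (gammaK m z τ)) = m := by
  have h : m.1 * τ ^ 2 / τ ^ 2 = m.1 := by field_simp
  have hdet : IsUnit (Am m.1 τ).det := by
    rw [det_Am hm, isUnit_iff_ne_zero]
    exact neg_ne_zero.mpr (by positivity)
  simp only [kmul_kinv_gammaK, psiArg, h, Prod.mk.eta]
  rw [← act_mul, Matrix.nonsing_inv_mul _ hdet, act_one]

/-- **Kinetic mollification as averaging along trajectories (eq:TrfK).**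
For every Schwartz `f`, every `τ > 0` and every `z = (t,x,v)`,
`∫ K_τ(z⁻¹ ∘ m) f(m) dm = ∫ f(γ^m(τ; z)) ψ(m) dm`. -/
theorem statement5 (d : ℕ) (hd : 1 ≤ d) (ψ : Pt d → ℝ) (hψ : IsKineticBump ψ)
    (f : SchwartzMap (Pt d) ℝ) (τ : ℝ) (hτ : 0 < τ) (z : Pt d) :
    ∫ m, Kker ψ τ (kmul (kinv z) m) * f m = ∫ m : Pt d, f (gammaK m z τ) * ψ m := by
  have hzero : ∀ m : Pt d, m.1 = 0 → ψ m = 0 := by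
    intro m hm
    by_contra h
    have := (hψ.supp m h).1
    rw [hm] at this
    norm_num at this
  have hψarg : ∀ m : Pt d, ψ (psiArg τ (kmul (kinv z) (gammaK m z τ))) = ψ m := by
    intro m
    by_cases hm : m.1 = 0
    · rw [hzero m hm, hzero _ (by simp [kmul_kinv_gammaK, psiArg, hm])]
    · rw [psiArg_kmul_kinv_gammaK hm z hτ]
  have hmeas : Measurable fun n : Pt d => f n * ψ (psiArg τ (kmul (kinv z) n)) := by
    have hk : Measurable fun n : Pt d => kmul (kinv z) n := by
      unfold kmul
      fun_prop
    exact f.continuous.measurable.mul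
      (hψ.smooth.continuous.measurable.comp ((measurable_psiArg τ).comp hk))
  have hmp := measurePreserving_gammaK hτ z
  calc ∫ m, Kker ψ τ (kmul (kinv z) m) * f m
      = (2 ^ d * τ ^ (-(4 * (d : ℤ) + 2))) * ∫ n, f n * ψ (psiArg τ (kmul (kinv z) n)) := by
        rw [← integral_const_mul]
        refine integral_congr_ae (.of_forall fun n => ?_)
        simp only [Kker]
        ring
    _ = ∫ n, f n * ψ (psiArg τ (kmul (kinv z) n))
          ∂(ENNReal.ofReal (2 ^ d * τ ^ (-(4 * (d : ℤ) + 2))) • (volume : Measure (Pt d))) := by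
        rw [integral_smul_measure, ENNReal.toReal_ofReal (by positivity), smul_eq_mul]
    _ = ∫ m, f (gammaK m z τ) * ψ (psiArg τ (kmul (kinv z) (gammaK m z τ))) := by
        rw [← hmp.map_eq, integral_map hmp.aemeasurable hmeas.aestronglyMeasurable]
    _ = ∫ m, f (gammaK m z τ) * ψ m := by simp only [hψarg]
end
end

section
/- (Lemma 2.2, gradient part.) For every r > 0 the kernels K_r, K̃_r, K⃗_r, K⃗^π_r are differentiable in the spatial kernel variable y, and there exists a constant C > 0 such that for every r > 0 and every (s,y,w) ∈ ℝ^{1+2d}: |∇_y K_r(s,y,w)| ≤ C r^{−Q−3}, |∇_y K⃗^π_r(s,y,w)| ≤ C r^{−Q−3}, |∇_y K⃗_r(s,y,w)| ≤ C r^{−Q−3}, and |∇_y K̃_r(s,y,w)| ≤ C r^{−Q−2}. -/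
open MeasureTheory Real ENNReal
open scoped RealInnerProductSpace

noncomputable section

theorem abs_three_sin_add_cos_le (x : ℝ) : |3 * sin x + cos x| ≤ 4 := by
  rw [abs_le]
  constructor <;> linarith [sin_le_one x, neg_one_le_sin x, cos_le_one x, neg_one_le_cos x]

theorem abs_three_cos_sub_sin_le (x : ℝ) : |3 * cos x - sin x| ≤ 4 := by
  rw [abs_le]
  constructor <;> linarith [sin_le_one x, neg_one_le_sin x, cos_le_one x, neg_one_le_cos x]

theorem abs_h1_le {r : ℝ} (hr : 0 < r) : |h1 r| ≤ 2 * r := by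
  rw [h1, abs_mul, abs_of_pos (by positivity : 0 < r / 2)]
  nlinarith [abs_three_sin_add_cos_le (log r)]

theorem abs_h2_le {r : ℝ} (hr : 0 < r) : |h2 r| ≤ 2 * r := by
  rw [h2, abs_mul, abs_of_pos (by positivity : 0 < r / 2)]
  nlinarith [abs_three_cos_sub_sin_le (log r)]

theorem abs_g1_le {r : ℝ} (hr : 0 < r) : |g1 r| ≤ r ^ 3 := by
  rw [g1, abs_mul, abs_of_pos (pow_pos hr 3)]
  exact mul_le_of_le_one_right (pow_pos hr 3).le (abs_sin_le_one _)

theorem abs_g2_le {r : ℝ} (hr : 0 < r) : |g2 r| ≤ r ^ 3 := by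
  rw [g2, abs_mul, abs_of_pos (pow_pos hr 3)]
  exact mul_le_of_le_one_right (pow_pos hr 3).le (abs_cos_le_one _)

theorem g1_mul_h2_sub (r : ℝ) : g1 r * h2 r - g2 r * h1 r = -(r ^ 4 / 2) := by
  simp only [g1, g2, h1, h2]
  linear_combination (-(r ^ 4 / 2)) * sin_sq_add_cos_sq (log r)

theorem Am_inv {m0 r : ℝ} (hm : m0 ≠ 0) (hr : 0 < r) :
    (Am m0 r)⁻¹ = !![-(2 / r ^ 4) * h2 r, 2 / r ^ 4 * (m0 * g2 r);
      2 / r ^ 4 * (h1 r / m0), -(2 / r ^ 4) * g1 r] := by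
  have hdet := g1_mul_h2_sub r
  have hD : (Dm m0)⁻¹ = !![m0⁻¹, 0; 0, 1] := by
    apply Matrix.inv_eq_right_inv
    ext i j
    fin_cases i <;> fin_cases j <;> simp [Dm, Matrix.mul_apply, hm]
  apply Matrix.inv_eq_right_inv
  rw [Am, hD, Dm, Wm]
  ext i j
  fin_cases i <;> fin_cases j <;> simp [Matrix.mul_apply] <;> field_simp <;>
    first | ring1 | linear_combination (-2) * hdet

theorem ne_zero_and_abs_mem {m0 : ℝ} (hm : m0 ∈ Set.Ioo (-2 : ℝ) (-1)) :
    m0 ≠ 0 ∧ 1 ≤ |m0| ∧ |m0| ≤ 2 := by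
  obtain ⟨h, h'⟩ := hm
  rw [abs_of_neg (by linarith)]
  exact ⟨by linarith, by linarith, by linarith⟩

theorem abs_Am_inv_zero_zero_le {m0 r : ℝ} (hm : m0 ∈ Set.Ioo (-2 : ℝ) (-1)) (hr : 0 < r) :
    |(Am m0 r)⁻¹ 0 0| ≤ 4 * r ^ (-3 : ℤ) := by
  have hc : 0 < 2 / r ^ 4 := by positivity
  rw [Am_inv (ne_zero_and_abs_mem hm).1 hr]
  calc |-(2 / r ^ 4) * h2 r| = 2 / r ^ 4 * |h2 r| := by rw [abs_mul, abs_neg, abs_of_pos hc]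
    _ ≤ 2 / r ^ 4 * (2 * r) := by gcongr; exact abs_h2_le hr
    _ = 4 * r ^ (-3 : ℤ) := by
      rw [zpow_neg]; norm_cast; field_simp; norm_num

theorem abs_Am_inv_one_zero_le {m0 r : ℝ} (hm : m0 ∈ Set.Ioo (-2 : ℝ) (-1)) (hr : 0 < r) :
    |(Am m0 r)⁻¹ 1 0| ≤ 4 * r ^ (-3 : ℤ) := by
  have hc : 0 < 2 / r ^ 4 := by positivity
  obtain ⟨h0, h1m, -⟩ := ne_zero_and_abs_mem hm
  rw [Am_inv h0 hr]
  calc |2 / r ^ 4 * (h1 r / m0)| = 2 / r ^ 4 * (|h1 r| / |m0|) := by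
        rw [abs_mul, abs_of_pos hc, abs_div]
    _ ≤ 2 / r ^ 4 * (2 * r) := by
      gcongr
      exact (div_le_self (abs_nonneg _) h1m).trans (abs_h1_le hr)
    _ = 4 * r ^ (-3 : ℤ) := by
      rw [zpow_neg]; norm_cast; field_simp; norm_num

theorem abs_Am_inv_zero_one_le {m0 r : ℝ} (hm : m0 ∈ Set.Ioo (-2 : ℝ) (-1)) (hr : 0 < r) :
    |(Am m0 r)⁻¹ 0 1| ≤ 4 * r ^ (-1 : ℤ) := by
  have hc : 0 < 2 / r ^ 4 := by positivity
  obtain ⟨h0, -, h2m⟩ := ne_zero_and_abs_mem hm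
  rw [Am_inv h0 hr]
  calc |2 / r ^ 4 * (m0 * g2 r)| = 2 / r ^ 4 * (|m0| * |g2 r|) := by
        rw [abs_mul, abs_of_pos hc, abs_mul]
    _ ≤ 2 / r ^ 4 * (2 * r ^ 3) := by
      gcongr
      exact abs_g2_le hr
    _ = 4 * r ^ (-1 : ℤ) := by
      rw [zpow_neg_one]; field_simp; norm_num

theorem abs_Am_inv_one_one_le {m0 r : ℝ} (hm : m0 ∈ Set.Ioo (-2 : ℝ) (-1)) (hr : 0 < r) :
    |(Am m0 r)⁻¹ 1 1| ≤ 4 * r ^ (-1 : ℤ) := by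
  have hc : 0 < 2 / r ^ 4 := by positivity
  rw [Am_inv (ne_zero_and_abs_mem hm).1 hr]
  calc |-(2 / r ^ 4) * g1 r| = 2 / r ^ 4 * |g1 r| := by rw [abs_mul, abs_neg, abs_of_pos hc]
    _ ≤ 2 / r ^ 4 * r ^ 3 := by gcongr; exact abs_g1_le hr
    _ = 2 * r ^ (-1 : ℤ) := by
      rw [zpow_neg_one]; field_simp
    _ ≤ 4 * r ^ (-1 : ℤ) := by gcongr; norm_num

theorem hasDerivAt_h1 {r : ℝ} (hr : 0 < r) :
    HasDerivAt h1 (sin (log r) + 2 * cos (log r)) r := by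
  have hl := hasDerivAt_log hr.ne'
  refine (((hasDerivAt_id r).div_const 2).mul ((hl.sin.const_mul 3).add hl.cos)).congr_deriv ?_
  simp only [id, Pi.add_apply]
  field_simp
  ring

theorem hasDerivAt_h2 {r : ℝ} (hr : 0 < r) :
    HasDerivAt h2 (cos (log r) - 2 * sin (log r)) r := by
  have hl := hasDerivAt_log hr.ne'
  refine (((hasDerivAt_id r).div_const 2).mul ((hl.cos.const_mul 3).sub hl.sin)).congr_deriv ?_
  simp only [id, Pi.sub_apply]
  field_simp
  ring

theorem abs_F1_le {m0 r : ℝ} (hm : m0 ∈ Set.Ioo (-2 : ℝ) (-1)) (hr : 0 < r) :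
    |F1 m0 r| ≤ 3 := by
  obtain ⟨-, h1m, -⟩ := ne_zero_and_abs_mem hm
  rw [F1, (hasDerivAt_h1 hr).deriv, one_div_mul_eq_div, abs_div]
  refine (div_le_self (abs_nonneg _) h1m).trans (abs_le.2 ?_)
  constructor <;> linarith [sin_le_one (log r), neg_one_le_sin (log r), cos_le_one (log r),
    neg_one_le_cos (log r)]

theorem abs_F2_le {r : ℝ} (hr : 0 < r) : |F2 r| ≤ 3 := by
  rw [F2, (hasDerivAt_h2 hr).deriv, abs_le]
  constructor <;> linarith [sin_le_one (log r), neg_one_le_sin (log r), cos_le_one (log r),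
    neg_one_le_cos (log r)]

theorem mkV_contDiff {d : ℕ} {E : Type*} [NormedAddCommGroup E] [NormedSpace ℝ E]
    {n : WithTop ℕ∞} {f : E → Fin d → ℝ} (hf : ∀ i, ContDiff ℝ n fun x => f x i) :
    ContDiff ℝ n fun x => mkV (f x) :=
  (EuclideanSpace.equiv (Fin d) ℝ).symm.contDiff.comp (contDiff_pi.2 hf)

theorem mkV_zero {d : ℕ} : mkV (fun _ : Fin d => 0) = 0 :=
  (EuclideanSpace.equiv (Fin d) ℝ).symm.map_zero

namespace IsKineticBump

variable {d : ℕ} {ψ : Pt d → ℝ}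

theorem fderiv_eq_zero (hψ : IsKineticBump ψ) {z : Pt d} (hz : ψ z = 0) : fderiv ℝ ψ z = 0 :=
  IsLocalMin.fderiv_eq_zero (Filter.Eventually.of_forall fun m => hz ▸ hψ.nonneg m)

theorem contDiff_fderiv_apply (hψ : IsKineticBump ψ) (v : Pt d) :
    ContDiff ℝ 1 fun z => fderiv ℝ ψ z v :=
  (hψ.smooth.fderiv_right (m := 1) (by norm_cast)).clm_apply contDiff_const

theorem hasCompactSupport (hψ : IsKineticBump ψ) {F : Type*} [Zero F] {Φ : Pt d → F}
    (hΦ : ∀ z, ψ z = 0 → Φ z = 0) : HasCompactSupport Φ := by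
  refine HasCompactSupport.intro (K := Set.Icc (-2 : ℝ) (-1) ×ˢ
    Metric.closedBall (0 : V d) 1 ×ˢ Metric.closedBall (0 : V d) 1)
    (isCompact_Icc.prod ((isCompact_closedBall _ _).prod (isCompact_closedBall _ _)))
    fun z hz => hΦ z ?_
  by_contra h
  obtain ⟨h0, h1, h2⟩ := hψ.supp z h
  exact hz ⟨Set.Ioo_subset_Icc_self h0, by simpa using h1.le, by simpa using h2.le⟩

/-- A `C¹` profile vanishing with the bump, rescaled by `psiArg` and multiplied by a
coefficient of size `r ^ p`, has `y`-derivative of size `r ^ (p - 3)`. -/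
theorem exists_fderiv_smul_comp_psiArg_le (hψ : IsKineticBump ψ) {F : Type*}
    [NormedAddCommGroup F] [NormedSpace ℝ F] {Φ : Pt d → F} (hΦ : ContDiff ℝ 1 Φ)
    (hΦ0 : ∀ z, ψ z = 0 → Φ z = 0) {k : ℝ → ℝ → ℝ} {B : ℝ} {p : ℤ}
    (hk : ∀ r s : ℝ, 0 < r → s / r ^ 2 ∈ Set.Ioo (-2 : ℝ) (-1) → |k r s| ≤ B * r ^ p) :
    ∃ C : ℝ, 0 < C ∧ ∀ r : ℝ, 0 < r → ∀ (s : ℝ) (w : V d),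
      Differentiable ℝ (fun y : V d => k r s • Φ (psiArg r (s, y, w))) ∧
      ∀ y : V d, ‖fderiv ℝ (fun y : V d => k r s • Φ (psiArg r (s, y, w))) y‖
        ≤ C * r ^ (p - 3) := by
  obtain ⟨M, hM⟩ := (hψ.hasCompactSupport hΦ0).fderiv (𝕜 := ℝ)
    |>.exists_bound_of_continuous (hΦ.continuous_fderiv one_ne_zero)
  have hM0 : 0 ≤ M := (norm_nonneg _).trans (hM 0)
  refine ⟨|B| * (M * 4) + 1, by positivity, fun r hr s w => ?_⟩
  by_cases hs : s / r ^ 2 ∈ Set.Ioo (-2 : ℝ) (-1)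
  · set A := (Am (s / r ^ 2) r)⁻¹ with hA
    let L : V d →L[ℝ] Pt d := (0 : V d →L[ℝ] ℝ).prod
      ((A 0 0 • ContinuousLinearMap.id ℝ (V d)).prod (A 1 0 • ContinuousLinearMap.id ℝ (V d)))
    have hL : ‖L‖ ≤ 4 * r ^ (-3 : ℤ) := by
      refine L.opNorm_le_bound (by positivity) fun y => ?_
      simp only [L, ContinuousLinearMap.prod_apply, zero_apply,
        smul_apply, ContinuousLinearMap.id_apply, Prod.norm_mk, norm_zero,
        norm_smul, Real.norm_eq_abs]
      refine max_le (by positivity) (max_le ?_ ?_)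
      · gcongr
        exact abs_Am_inv_zero_zero_le hs hr
      · gcongr
        exact abs_Am_inv_one_zero_le hs hr
    have harg : ∀ y, HasFDerivAt (fun y : V d => psiArg r (s, y, w)) L y := by
      intro y
      have he : (fun y : V d => psiArg r (s, y, w)) =
          fun y => L y + (s / r ^ 2, A 0 1 • w, A 1 1 • w) := by
        ext1 y
        simp [psiArg, act, L, hA]
      rw [he]
      exact L.hasFDerivAt.add_const _
    have hcomp : ∀ y, HasFDerivAt (fun y : V d => k r s • Φ (psiArg r (s, y, w)))
        (k r s • (fderiv ℝ Φ (psiArg r (s, y, w))).comp L) y := fun y =>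
      (((hΦ.differentiable one_ne_zero _).hasFDerivAt).comp y (harg y)).const_smul (k r s)
    refine ⟨fun y => (hcomp y).differentiableAt, fun y => ?_⟩
    rw [(hcomp y).fderiv, norm_smul, Real.norm_eq_abs]
    calc |k r s| * ‖(fderiv ℝ Φ (psiArg r (s, y, w))).comp L‖
        ≤ (|B| * r ^ p) * (M * (4 * r ^ (-3 : ℤ))) := by
          refine mul_le_mul ((hk r s hr hs).trans ?_) ?_ (norm_nonneg _) (by positivity)
          · gcongr
            exact le_abs_self B
          · exact (ContinuousLinearMap.opNorm_comp_le _ _).trans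
              (mul_le_mul (hM _) hL (norm_nonneg _) hM0)
      _ = |B| * (M * 4) * r ^ (p - 3) := by
          rw [sub_eq_add_neg, zpow_add₀ hr.ne']; ring
      _ ≤ _ := by gcongr; linarith
  · have h0 : (fun y : V d => k r s • Φ (psiArg r (s, y, w))) = fun _ => 0 := by
      ext1 y
      rw [hΦ0, smul_zero]
      by_contra h
      exact hs (hψ.supp _ h).1
    rw [h0]
    refine ⟨differentiable_const _, fun y => ?_⟩
    rw [fderiv_fun_const, Pi.zero_apply, norm_zero]
    positivity

end IsKineticBump

theorem abs_mul_zpow_le {s r : ℝ} (hr : 0 < r) (hs : s / r ^ 2 ∈ Set.Ioo (-2 : ℝ) (-1))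
    (n : ℕ) (p : ℤ) : |2 ^ n * s * r ^ p| ≤ 2 ^ n * 2 * r ^ (p + 2) := by
  have h := (ne_zero_and_abs_mem hs).2.2
  rw [abs_div, abs_of_pos (pow_pos hr 2), div_le_iff₀ (pow_pos hr 2)] at h
  rw [abs_mul, abs_mul, abs_of_pos (zpow_pos hr p), abs_of_pos (by positivity : (0 : ℝ) < 2 ^ n)]
  calc 2 ^ n * |s| * r ^ p ≤ 2 ^ n * (2 * r ^ 2) * r ^ p := by gcongr
    _ = _ := by rw [zpow_add₀ hr.ne', zpow_ofNat]; ring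

/-- **Lemma 2.2, gradient part.** For every `r > 0` the kernels are differentiable in the
spatial kernel variable `y`, and there is `C > 0` such that for every `r > 0` and every
`(s,y,w)`: `|∇_y K_r| ≤ C r^{−Q−3}`, `|∇_y K⃗^π_r| ≤ C r^{−Q−3}`, `|∇_y K⃗_r| ≤ C r^{−Q−3}`,
and `|∇_y K̃_r| ≤ C r^{−Q−2}`, with `Q = 4d+2`. -/
theorem statement9 (d : ℕ) (hd : 1 ≤ d) (ψ : Pt d → ℝ) (hψ : IsKineticBump ψ) :
    ∃ C : ℝ, 0 < C ∧ ∀ r : ℝ, 0 < r →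
      ((∀ (s : ℝ) (w : V d), Differentiable ℝ fun y : V d => Kker ψ r (s, y, w)) ∧
       (∀ (s : ℝ) (w : V d), Differentiable ℝ fun y : V d => Ktil ψ r (s, y, w)) ∧
       (∀ (s : ℝ) (w : V d), Differentiable ℝ fun y : V d => Kvec ψ r (s, y, w)) ∧
       (∀ (s : ℝ) (w : V d), Differentiable ℝ fun y : V d => Kpi ψ r (s, y, w))) ∧
      ∀ (s : ℝ) (y w : V d),
        ‖fderiv ℝ (fun y : V d => Kker ψ r (s, y, w)) y‖ ≤ C * r ^ (-(4 * (d : ℤ) + 2) - 3) ∧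
        ‖fderiv ℝ (fun y : V d => Kpi ψ r (s, y, w)) y‖ ≤ C * r ^ (-(4 * (d : ℤ) + 2) - 3) ∧
        ‖fderiv ℝ (fun y : V d => Kvec ψ r (s, y, w)) y‖ ≤ C * r ^ (-(4 * (d : ℤ) + 2) - 3) ∧
        ‖fderiv ℝ (fun y : V d => Ktil ψ r (s, y, w)) y‖ ≤ C * r ^ (-(4 * (d : ℤ) + 2) - 2) := by
  set q : ℤ := -(4 * (d : ℤ) + 2) with hq
  have hψ1 : ContDiff ℝ 1 ψ := hψ.smooth.of_le (by norm_cast)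
  obtain ⟨C₁, hC₁, H₁⟩ := hψ.exists_fderiv_smul_comp_psiArg_le hψ1 (fun _ h => h)
    (k := fun r _ => 2 ^ d * r ^ q) (B := 2 ^ d) (p := q) fun r s hr _ =>
      (abs_of_pos (by positivity)).le
  obtain ⟨C₂, hC₂, H₂⟩ := hψ.exists_fderiv_smul_comp_psiArg_le hψ1 (fun _ h => h)
    (k := fun r s => -(2 ^ (d + 1)) * s * r ^ (q - 1)) (B := 2 ^ (d + 1) * 2) (p := q - 1 + 2)
    fun r s hr hs => by
      simpa only [neg_mul, abs_neg] using abs_mul_zpow_le hr hs (d + 1) (q - 1)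
  have hvec : ∀ (f : ℝ → ℝ → ℝ),
      (∀ r s : ℝ, 0 < r → s / r ^ 2 ∈ Set.Ioo (-2 : ℝ) (-1) → |f r s| ≤ 3) →
      ∀ r s : ℝ, 0 < r → s / r ^ 2 ∈ Set.Ioo (-2 : ℝ) (-1) →
        |-(2 ^ d) * r ^ q * f r s| ≤ 2 ^ d * 3 * r ^ q := by
    intro f hf r s hr hs
    rw [neg_mul, neg_mul, abs_neg, abs_mul, abs_of_pos (by positivity : 0 < 2 ^ d * r ^ q)]
    calc 2 ^ d * r ^ q * |f r s| ≤ 2 ^ d * r ^ q * 3 := by gcongr; exact hf r s hr hs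
      _ = _ := by ring
  obtain ⟨C₃, hC₃, H₃⟩ := hψ.exists_fderiv_smul_comp_psiArg_le
    (Φ := fun z => ψ z • z.2.1) (hψ1.smul (by fun_prop)) (fun z h => by simp [h])
    (hvec (fun r s => F1 (s / r ^ 2) r) fun r s hr hs => abs_F1_le hs hr)
  obtain ⟨C₄, hC₄, H₄⟩ := hψ.exists_fderiv_smul_comp_psiArg_le
    (Φ := fun z => ψ z • z.2.2) (hψ1.smul (by fun_prop)) (fun z h => by simp [h])
    (hvec (fun r _ => F2 r) fun r s hr _ => abs_F2_le hr)
  have hpi : ∀ (f : ℝ → ℝ → ℝ),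
      (∀ r s : ℝ, 0 < r → s / r ^ 2 ∈ Set.Ioo (-2 : ℝ) (-1) → |f r s| ≤ 4 * r ^ (-1 : ℤ)) →
      ∀ r s : ℝ, 0 < r → s / r ^ 2 ∈ Set.Ioo (-2 : ℝ) (-1) →
        |2 ^ (d + 1) * s * r ^ (q - 1) * f r s| ≤ 2 ^ (d + 1) * 2 * 4 * r ^ q := by
    intro f hf r s hr hs
    rw [abs_mul]
    calc _ ≤ 2 ^ (d + 1) * 2 * r ^ (q - 1 + 2) * (4 * r ^ (-1 : ℤ)) :=
          mul_le_mul (abs_mul_zpow_le hr hs (d + 1) (q - 1)) (hf r s hr hs) (abs_nonneg _)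
            (by positivity)
      _ = 2 ^ (d + 1) * 2 * 4 * (r ^ (q - 1 + 2) * r ^ (-1 : ℤ)) := by ring
      _ = _ := by rw [← zpow_add₀ hr.ne']; ring_nf
  obtain ⟨C₅, hC₅, H₅⟩ := hψ.exists_fderiv_smul_comp_psiArg_le (Φ := gradX ψ)
    (mkV_contDiff fun i => hψ.contDiff_fderiv_apply _)
    (fun z h => by simp [gradX, hψ.fderiv_eq_zero h, mkV_zero])
    (hpi (fun r s => (Am (s / r ^ 2) r)⁻¹ 0 1) fun r s hr hs => abs_Am_inv_zero_one_le hs hr)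
  obtain ⟨C₆, hC₆, H₆⟩ := hψ.exists_fderiv_smul_comp_psiArg_le (Φ := gradV ψ)
    (mkV_contDiff fun i => hψ.contDiff_fderiv_apply _)
    (fun z h => by simp [gradV, hψ.fderiv_eq_zero h, mkV_zero])
    (hpi (fun r s => (Am (s / r ^ 2) r)⁻¹ 1 1) fun r s hr hs => abs_Am_inv_one_one_le hs hr)
  have eK : ∀ r s w, (fun y : V d => Kker ψ r (s, y, w)) =
      fun y => (2 ^ d * r ^ q) • ψ (psiArg r (s, y, w)) := fun r s w => rfl
  have eT : ∀ r s w, (fun y : V d => Ktil ψ r (s, y, w)) =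
      fun y => (-(2 ^ (d + 1)) * s * r ^ (q - 1)) • ψ (psiArg r (s, y, w)) := fun r s w => rfl
  have eV : ∀ r s w, (fun y : V d => Kvec ψ r (s, y, w)) =
      (fun y => (-(2 ^ d) * r ^ q * F1 (s / r ^ 2) r) •
        (ψ (psiArg r (s, y, w)) • (psiArg r (s, y, w)).2.1)) +
      fun y => (-(2 ^ d) * r ^ q * F2 r) •
        (ψ (psiArg r (s, y, w)) • (psiArg r (s, y, w)).2.2) := by
    intro r s w
    ext1 y
    simp only [Kvec, Pi.add_apply, smul_add, smul_smul, psiArg, ← hq]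
    congr 2 <;> ring
  have eP : ∀ r s w, (fun y : V d => Kpi ψ r (s, y, w)) =
      (fun y => (2 ^ (d + 1) * s * r ^ (q - 1) * (Am (s / r ^ 2) r)⁻¹ 0 1) •
        gradX ψ (psiArg r (s, y, w))) +
      fun y => (2 ^ (d + 1) * s * r ^ (q - 1) * (Am (s / r ^ 2) r)⁻¹ 1 1) •
        gradV ψ (psiArg r (s, y, w)) := by
    intro r s w
    ext1 y
    simp only [Kpi, Pi.add_apply, smul_add, smul_smul, ← hq]
  refine ⟨C₁ + C₂ + C₃ + C₄ + C₅ + C₆, by positivity, fun r hr => ⟨⟨fun s w => ?_, fun s w => ?_,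
    fun s w => ?_, fun s w => ?_⟩, fun s y w => ⟨?_, ?_, ?_, ?_⟩⟩⟩
  · exact (H₁ r hr s w).1
  · exact (H₂ r hr s w).1
  · rw [eV]
    exact (H₃ r hr s w).1.add (H₄ r hr s w).1
  · rw [eP]
    exact (H₅ r hr s w).1.add (H₆ r hr s w).1
  · rw [eK]
    refine ((H₁ r hr s w).2 y).trans ?_
    gcongr
    linarith
  · rw [eP, fderiv_add ((H₅ r hr s w).1 y) ((H₆ r hr s w).1 y)]
    refine (norm_add_le_of_le ((H₅ r hr s w).2 y) ((H₆ r hr s w).2 y)).trans ?_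
    rw [← add_mul]
    exact mul_le_mul_of_nonneg_right (by linarith) (by positivity)
  · rw [eV, fderiv_add ((H₃ r hr s w).1 y) ((H₄ r hr s w).1 y)]
    refine (norm_add_le_of_le ((H₃ r hr s w).2 y) ((H₄ r hr s w).2 y)).trans ?_
    rw [← add_mul]
    exact mul_le_mul_of_nonneg_right (by linarith) (by positivity)
  · rw [eT, show q - 2 = q - 1 + 2 - 3 by ring]
    refine ((H₂ r hr s w).2 y).trans ?_
    gcongr
    linarith
end
end
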